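/- Under the hypotheses m > 2|T|, y = A x₀, and |T|+1 ≤ L ≤ m−|T|−1, the support identified by the subspace criterion is exact: an index k ∈ {0,…,n−1} satisfies a_k^L ∈ Ran Y (equivalently the angle between a_k^L and Ran Y is zero) if and only if k ∈ T. Consequently, solving A_T x_T = y with x restricted to this identified support recovers x = x₀. -/

import Mathlib

open Complex

noncomputable def partialFourier (m n : ℕ) : Matrix (Fin m) (Fin n) ℂ :=
  Matrix.of fun j k => Complex.exp (2 * Real.pi * Complex.I * j * k / n)

def hankel (m L : ℕ) (y : Fin m → ℂ) : Matrix (Fin L) (Fin (m - L)) ℂ :=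
  Matrix.of fun p q => y ⟨p.1 + q.1, by have := p.2; have := q.2; omega⟩

open Polynomial in
lemma eval_fin_sum (P : ℂ[X]) (N : ℕ) (h : P.natDegree < N) (z : ℂ) :
    ∑ j : Fin N, P.coeff j * z ^ (j : ℕ) = P.eval z := by
  rw [Polynomial.eval_eq_sum_range' h, ← Fin.sum_univ_eq_sum_range (fun j => P.coeff j * z ^ j)]

noncomputable def znode (n : ℕ) (k : Fin n) : ℂ := Complex.exp (2 * Real.pi * Complex.I / n) ^ (k : ℕ)

lemma pf_eq (m n : ℕ) (j : Fin m) (k : Fin n) :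
    partialFourier m n j k = znode n k ^ (j : ℕ) := by
  simp only [partialFourier, znode, Matrix.of_apply]
  rw [← pow_mul, ← Complex.exp_nat_mul]
  congr 1
  push_cast
  ring

lemma znode_inj (n : ℕ) : Function.Injective (znode n) := by
  intro a b h
  have hn : n ≠ 0 := by have := a.2; omega
  exact Fin.ext ((Complex.isPrimitiveRoot_exp n hn).pow_inj a.2 b.2 h)

noncomputable def annih {n : ℕ} (S : Finset (Fin n)) : Polynomial ℂ :=
  ∏ l ∈ S, (Polynomial.X - Polynomial.C (znode n l))

lemma annih_deg {n : ℕ} (S : Finset (Fin n)) : (annih S).natDegree = S.card := by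
  simp [annih, Polynomial.natDegree_finsetProd_X_sub_C_eq_card]

lemma annih_eval {n : ℕ} (S : Finset (Fin n)) (k : Fin n) :
    (annih S).eval (znode n k) = 0 ↔ k ∈ S := by
  rw [annih, Polynomial.eval_prod, Finset.prod_eq_zero_iff]
  constructor
  · rintro ⟨l, hl, h⟩
    have : znode n k = znode n l := by simpa [sub_eq_zero] using h
    rwa [znode_inj n this]
  · intro h
    exact ⟨k, h, by simp⟩

open Polynomial in
/-- moments against a shifted polynomial -/
lemma moment_sum {n : ℕ} (P : ℂ[X]) (N s : ℕ) (h : P.natDegree < N) (x : Fin n → ℂ) :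
    ∑ j : Fin N, P.coeff j * ∑ l, znode n l ^ (s + (j : ℕ)) * x l
      = ∑ l, x l * znode n l ^ s * P.eval (znode n l) := by
  simp_rw [← eval_fin_sum P N h, Finset.mul_sum]
  rw [Finset.sum_comm]
  refine Finset.sum_congr rfl fun l _ => Finset.sum_congr rfl fun j _ => ?_
  ring

lemma erase_sum {n : ℕ} (T : Finset (Fin n)) (x : Fin n → ℂ) (hx : ∀ k, k ∉ T → x k = 0)
    (k : Fin n) (s : ℕ) :
    ∑ l, x l * znode n l ^ s * (annih (T.erase k)).eval (znode n l)
      = x k * znode n k ^ s * (annih (T.erase k)).eval (znode n k) := by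
  refine Finset.sum_eq_single k (fun l _ hl => ?_) (by simp)
  by_cases h : l ∈ T
  · rw [(annih_eval _ l).2 (Finset.mem_erase.2 ⟨hl, h⟩), mul_zero]
  · rw [hx l h]; simp

/-- Noiseless subspace identification is exact: with `m > 2|T|`, `y = A x₀`,
and `|T|+1 ≤ L ≤ m−|T|−1`, an index `k` satisfies `a_k^L ∈ Ran Y` iff `k ∈ T`;
consequently solving the system on the identified support recovers `x₀`. -/
theorem superset_noiseless_recovery (m n L : ℕ) (hmn : m ≤ n)
    (hspark : ∀ f : Fin m → Fin n, Function.Injective f →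
      LinearIndependent ℂ (fun i : Fin m => fun j : Fin m => partialFourier m n j (f i)))
    (x₀ : Fin n → ℂ) (T : Finset (Fin n)) (hsupp : ∀ k, x₀ k ≠ 0 ↔ k ∈ T)
    (hm : 2 * T.card < m) (hL1 : T.card + 1 ≤ L) (hL2 : L ≤ m - T.card - 1)
    (y : Fin m → ℂ) (hy : y = (partialFourier m n).mulVec x₀) :
    (∀ k : Fin n,
      ((fun p : Fin L => partialFourier m n ⟨p.1, by have := p.2; omega⟩ k) ∈
        Submodule.span ℂ
          (Set.range fun q : Fin (m - L) => fun p : Fin L => hankel m L y p q)) ↔ k ∈ T) ∧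
    (∀ x : Fin n → ℂ, (∀ k, k ∉ T → x k = 0) →
      (partialFourier m n).mulVec x = y → x = x₀) := by
  have hx0 : ∀ k, k ∉ T → x₀ k = 0 := fun k hk => by
    by_contra h
    exact hk ((hsupp k).1 h)
  have hyj : ∀ j : Fin m, y j = ∑ l, znode n l ^ (j : ℕ) * x₀ l := fun j => by
    rw [hy]; simp [Matrix.mulVec, dotProduct, pf_eq]
  refine ⟨fun k => ⟨fun h => ?_, fun hk => ?_⟩, fun x hx hxy => ?_⟩
  · let φ : (Fin L → ℂ) →ₗ[ℂ] ℂ := ∑ p : Fin L, (annih T).coeff p • LinearMap.proj p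
    have hφ : ∀ v, φ v = ∑ p : Fin L, (annih T).coeff p * v p := fun v => by
      simp [φ, LinearMap.sum_apply]
    have hdeg : (annih T).natDegree < L := by rw [annih_deg]; omega
    have hle : Submodule.span ℂ
          (Set.range fun q : Fin (m - L) => fun p : Fin L => hankel m L y p q)
          ≤ LinearMap.ker φ := by
      rw [Submodule.span_le]
      rintro _ ⟨q, rfl⟩
      simp only [SetLike.mem_coe, LinearMap.mem_ker, hφ, hankel, Matrix.of_apply, hyj]
      simp_rw [add_comm _ (q : ℕ)]
      rw [moment_sum _ _ _ hdeg]
      refine Finset.sum_eq_zero fun l _ => ?_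
      by_cases hl : l ∈ T
      · rw [(annih_eval _ l).2 hl, mul_zero]
      · rw [hx0 l hl]; simp
    have h2 := hle h
    simp only [LinearMap.mem_ker, hφ, pf_eq] at h2
    rw [eval_fin_sum _ _ hdeg] at h2
    exact (annih_eval T k).1 h2
  · have hc : x₀ k * (annih (T.erase k)).eval (znode n k) ≠ 0 :=
      mul_ne_zero ((hsupp k).2 hk) (fun h => by simpa using (annih_eval _ k).1 h)
    have hdeg : (annih (T.erase k)).natDegree < m - L := by
      rw [annih_deg, Finset.card_erase_of_mem hk]; omega
    rw [← Submodule.smul_mem_iff _ hc]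
    have hmem : ∑ q : Fin (m - L), (annih (T.erase k)).coeff q •
        (fun p : Fin L => hankel m L y p q) ∈ Submodule.span ℂ
          (Set.range fun q : Fin (m - L) => fun p : Fin L => hankel m L y p q) :=
      Submodule.sum_mem _ fun q _ => Submodule.smul_mem _ _ (Submodule.subset_span ⟨q, rfl⟩)
    convert hmem using 1
    funext p
    simp only [Finset.sum_apply, Pi.smul_apply, smul_eq_mul, hankel, Matrix.of_apply, hyj, pf_eq]
    rw [moment_sum _ _ _ hdeg, erase_sum T x₀ hx0]
    ring
  · funext k
    by_cases hk : k ∈ T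
    · have hdeg : (annih (T.erase k)).natDegree < m := by
        rw [annih_deg, Finset.card_erase_of_mem hk]; omega
      have key : ∀ j : Fin m, ∑ l, znode n l ^ (0 + (j : ℕ)) * x l
          = ∑ l, znode n l ^ (0 + (j : ℕ)) * x₀ l := fun j => by
        have h1 := congrFun hxy j
        rw [hyj j] at h1
        simpa [Matrix.mulVec, dotProduct, pf_eq] using h1
      have e1 := moment_sum _ _ 0 hdeg x
      have e2 := moment_sum _ _ 0 hdeg x₀
      simp_rw [key] at e1
      rw [e2, erase_sum T x₀ hx0, erase_sum T x hx] at e1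
      have hne : (annih (T.erase k)).eval (znode n k) ≠ 0 :=
        fun h => by simpa using (annih_eval _ k).1 h
      have := mul_right_cancel₀ hne e1
      simpa using this.symm
    · rw [hx k hk, hx0 k hk]
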